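/- Let R be a *-ring and p, q projectors such that p - q, p(1-q) and q(1-p) are *-cancellable. Then p - q is Moore-Penrose invertible if and only if 1 - pq is Moore-Penrose invertible. -/

import Mathlib

/-- `b` is a Moore-Penrose inverse of `a`. -/
def IsMP {R : Type*} [Ring R] [StarRing R] (a b : R) : Prop :=
  a * b * a = a ∧ b * a * b = b ∧ star (a * b) = a * b ∧ star (b * a) = b * a

/-- `p` is a projector: `p² = p = p*`. -/
def IsProjector {R : Type*} [Ring R] [StarRing R] (p : R) : Prop :=
  p * p = p ∧ star p = p

/-- `a` is *-cancellable. -/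
def StarCancellable {R : Type*} [Ring R] [StarRing R] (a : R) : Prop :=
  (∀ x : R, star a * a * x = 0 → a * x = 0) ∧ (∀ x : R, x * (a * star a) = 0 → x * a = 0)

theorem aux_back {R : Type*} [Ring R] [StarRing R] (p q x : R)
    (hp : IsProjector p) (hq : IsProjector q)
    (hc0 : StarCancellable (p - q)) (hx : IsMP (1 - p * q) x) :
    (p - q) * p = (p - q) * ((p - q) * (p - q) * (p * star x)) := by
  obtain ⟨hp1, hp2⟩ := hp
  obtain ⟨hq1, hq2⟩ := hq
  obtain ⟨h1, h2, h3, h4⟩ := hx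
  obtain ⟨G, hG⟩ : ∃ G, G = 1 - x * (1 - p * q) := ⟨_, rfl⟩
  have hGs : star G = G := by rw [hG, star_sub, star_one, h4]
  have haG : (1 - p * q) * G = 0 := by rw [hG, mul_sub, ← mul_assoc, h1]; simp
  have e1 : p * (q * G) = G := by
    rw [sub_mul, one_mul, mul_assoc] at haG; exact (sub_eq_zero.mp haG).symm
  have e2 : p * G = G := by
    rw [← e1, ← mul_assoc, hp1]
  have hd : (p - q) * G = 0 := by
    apply hc0.1
    rw [star_sub, hp2, hq2]
    have : (p - q) * (p - q) * G = p * p * G - p * (q * G) - q * (p * G) + q * q * G := by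
      noncomm_ring
    rw [this, hp1, hq1, e1, e2]; abel
  have hA : (1 - p * q) * p = p * ((p - q) * (p - q)) := by
    have : p * ((p - q) * (p - q)) = p * p * p - p * p * q - p * q * p + p * (q * q) := by
      noncomm_ring
    rw [this, hp1, hq1, hp1]; noncomm_ring
  have hGp : G * p = G := by
    have := congrArg star e2
    rwa [star_mul, hGs, hp2] at this
  have e3 : x * (p * ((p - q) * (p - q))) = p - G := by
    rw [← hA, ← mul_assoc]
    have : x * (1 - p * q) = 1 - G := by rw [hG]; abel
    rw [this, sub_mul, hGp, one_mul]
  have e4 := congrArg star e3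
  simp only [star_mul, star_sub, hp2, hq2, hGs] at e4
  have : (p - q) * p = (p - q) * (p - G) := by rw [mul_sub _ p G, hd, sub_zero]
  rw [this, ← e4]; simp only [mul_assoc]

theorem aux_self {R : Type*} [Ring R] [StarRing R] (d v : R) (hd : star d = d)
    (h : d = d * d * v) : ∃ x, IsMP d x := by
  have h' : star v * (d * d) = d := by
    have := congrArg star h
    simp only [star_mul, hd] at this
    exact this.symm
  have hQ : star v * d = d * v := by
    calc star v * d = star v * (d * d * v) := by rw [← h]
      _ = star v * (d * d) * v := by simp only [mul_assoc]
      _ = _ := by rw [h']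
  have hQs : star (d * v) = d * v := by rw [star_mul, hd, hQ]
  have hQd : d * v * d = d := by rw [← hQ, mul_assoc, h']
  have a1 : d * (d * v * v) = d * v := by
    rw [← mul_assoc, ← mul_assoc, ← h]
  have a2 : d * v * v * d = d * v := by
    have : star (d * v * v) = d * v * v := by
      rw [star_mul, hQs, ← mul_assoc, hQ]
    have h5 := congrArg star a1
    rwa [star_mul, this, hd, hQs] at h5
  refine ⟨d * v * v, ?_, ?_, ?_, ?_⟩
  · rw [a1, hQd]
  · rw [a2]
    calc d * v * (d * v * v) = (d * v * d) * v * v := by simp only [mul_assoc]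
      _ = _ := by rw [hQd]
  · rw [a1, hQs]
  · rw [a2, hQs]

theorem aux_fwd {R : Type*} [Ring R] [StarRing R] (p q t : R)
    (hp : IsProjector p) (hq : IsProjector q)
    (hx : IsMP (p - q) t) : ∃ x, IsMP (1 - p * q) x := by
  obtain ⟨hp1, hp2⟩ := hp
  obtain ⟨hq1, hq2⟩ := hq
  obtain ⟨h1, h2, h3, h4⟩ := hx
  obtain ⟨d, hdd⟩ : ∃ d, d = p - q := ⟨_, rfl⟩
  rw [← hdd] at h1 h2 h3 h4
  have hd : star d = d := by rw [hdd, star_sub, hp2, hq2]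
  have s3 : star t * d = d * t := by rw [← h3, star_mul, hd]
  have s4 : d * star t = t * d := by rw [← h4, star_mul, hd]
  have hdt : d * t = t * d := by
    -- star t * d = d * t, d * star t = t * d
    have k1 : d * d * t = d := by
      have := congrArg star h1
      rw [star_mul, star_mul, hd, s3] at this
      rw [mul_assoc]; exact this
    have k2 : t * (d * d) = d := by
      rw [← mul_assoc, ← s4, mul_assoc, s3, ← mul_assoc, k1]
    calc d * t = t * (d * d) * t := by rw [k2]
      _ = t * (d * d * t) := by simp only [mul_assoc]
      _ = t * d := by rw [k1]
  obtain ⟨P, hP⟩ : ∃ P, P = d * t := ⟨_, rfl⟩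
  obtain ⟨e, he⟩ : ∃ e, e = t * t := ⟨_, rfl⟩
  obtain ⟨D, hD⟩ : ∃ D, D = d * d := ⟨_, rfl⟩
  have hPs : star P = P := by rw [hP, h3]
  have Pd : P * d = d := by rw [hP, h1]
  have dP : d * P = d := by rw [hP, hdt, ← mul_assoc, h1]
  have Pt : P * t = t := by rw [hP, hdt, h2]
  have tP : t * P = t := by rw [hP, ← mul_assoc, h2]
  have De : D * e = P := by
    rw [hD, he, mul_assoc, ← mul_assoc d t t, ← hP, Pt, hP]
  have eD : e * D = P := by
    rw [hD, he, mul_assoc, ← mul_assoc t d d, ← hdt, ← hP, Pd, hP, hdt]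
  have PD : P * D = D := by rw [hD, ← mul_assoc, Pd]
  have DP : D * P = D := by rw [hD, mul_assoc, dP]
  have Pe : P * e = e := by rw [he, ← mul_assoc, Pt]
  have eP : e * P = e := by rw [he, mul_assoc, tP]
  have pD : p * D = p - p * q * p := by
    have : p * ((p - q) * (p - q)) = p * p * p - p * p * q - p * q * p + p * (q * q) := by
      noncomm_ring
    rw [hD, hdd, this, hp1, hq1, hp1]; noncomm_ring
  have Dp : D * p = p - p * q * p := by
    have := congrArg star pD
    simp only [hD, star_mul, star_sub, hd, hp2, hq2] at this
    rw [hD, this]; simp only [mul_assoc]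
  have cD : p * D = D * p := by rw [pD, Dp]
  have cP : P * p = p * P := by
    have u1 : P * p * P = P * p := by
      rw [← eD, mul_assoc e D p, ← cD, eD, mul_assoc, mul_assoc, DP]
    have u2 := congrArg star u1
    simp only [star_mul, hPs, hp2] at u2
    rw [← u1, mul_assoc, u2]
  have ce : e * p = p * e := by
    calc e * p = e * P * p := by rw [eP]
      _ = e * (p * D) * e := by rw [mul_assoc, cP, ← De]; simp only [mul_assoc]
      _ = (e * D) * p * e := by rw [cD]; simp only [mul_assoc]
      _ = p * e := by rw [eD, cP, mul_assoc, Pe]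
  have Pq : P * q = q - p + p * P := by
    have : P * p - P * q = p - q := by rw [← mul_sub, ← hdd, Pd]
    rw [cP] at this
    rw [← sub_eq_zero] at this ⊢
    rw [← neg_eq_zero, ← this]; abel
  obtain ⟨B, hB⟩ : ∃ B, B = p * q * (1 - p) := ⟨_, rfl⟩
  obtain ⟨E, hE⟩ : ∃ E, E = 1 - p + p * P := ⟨_, rfl⟩
  obtain ⟨h, hh⟩ : ∃ h, h = 1 - p + p * e := ⟨_, rfl⟩
  obtain ⟨g, hg⟩ : ∃ g, g = 1 - p + p * D := ⟨_, rfl⟩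
  have pz : p * (1 - p) = 0 := by rw [mul_sub, hp1, mul_one, sub_self]
  have zp : (1 - p) * p = 0 := by rw [sub_mul, hp1, one_mul, sub_self]
  have zz : (1 - p) * (1 - p) = 1 - p := by rw [sub_mul (1:R), pz, one_mul, sub_zero]
  have key : ∀ a b : R, a * p = p * a → 
      (1 - p + p * a) * (1 - p + p * b) = 1 - p + p * (a * b) := by
    intro a b ha
    have : (1 - p + p * a) * (1 - p + p * b) = (1 - p) * (1 - p) + (1 - p) * p * b
        + p * a * (1 - p) + p * a * p * b := by noncomm_ring
    have w : p * a * (1 - p) = 0 := by rw [← ha, mul_assoc, pz, mul_zero]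
    have w2 : p * a * p = p * a := by rw [mul_assoc, ha, ← mul_assoc, hp1]
    rw [this, zz, zp, w, w2]; noncomm_ring
  have gh : g * h = E := by rw [hg, hh, hE, key _ _ cD.symm, De]
  have hg' : h * g = E := by rw [hg, hh, hE, key _ _ ce, eD]
  have Eg : E * g = g := by rw [hg, hE, key _ _ cP, PD]
  have Eh : E * h = h := by rw [hh, hE, key _ _ cP, Pe]
  have BE : B * E = B := by
    have : B * E = p * q * ((1 - p) * (1 - p)) + p * q * ((1 - p) * p) * P := by
      rw [hB, hE]; noncomm_ring
    rw [this, zz, zp, hB]; noncomm_ring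
  have EB : E * B = B := by
    have : E * B = (1 - p) * p * (q * (1 - p)) + p * (P * p) * (q * (1 - p)) := by
      rw [hB, hE]; noncomm_ring
    rw [this, zp, cP, ← mul_assoc p p P, hp1]
    have : p * P * (q * (1 - p)) = p * (P * q) * (1 - p) := by simp only [mul_assoc]
    rw [zero_mul, zero_add, this, Pq, ← cP]
    have : p * (q - p + P * p) * (1 - p) = p * q * (1 - p) - p * (p * (1 - p)) 
      + p * P * (p * (1 - p)) := by noncomm_ring
    rw [this, pz, hB]; simp
  have BB : B * B = 0 := by
    have : B * B = p * q * ((1 - p) * p) * (q * (1 - p)) := by rw [hB]; noncomm_ring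
    rw [this, zp]; simp
  have Es : star E = E := by
    rw [hE]; simp only [star_add, star_sub, star_mul, star_one, hp2, hPs, cP]
  have ha : 1 - p * q = (1 - B) * g := by
    have : (1 - B) * g = 1 - p + p * D - p * q * ((1 - p) * (1 - p)) 
       - p * q * ((1 - p) * p) * D := by
      rw [hB, hg]; noncomm_ring
    rw [this, zz, zp, pD]; noncomm_ring
  have i1 : (1 - B) * (1 + B) = 1 := by
    have : (1 - B) * (1 + B) = 1 - B * B := by noncomm_ring
    rw [this, BB, sub_zero]
  have i2 : (1 + B) * (1 - B) = 1 := by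
    have : (1 + B) * (1 - B) = 1 - B * B := by noncomm_ring
    rw [this, BB, sub_zero]
  have ax : (1 - B) * g * (h * (1 + B)) = E := by
    have : (1 - B) * g * (h * (1 + B)) = (1 - B) * (g * h) * (1 + B) := by simp only [mul_assoc]
    have w : (1 - B) * E = E * (1 - B) := by rw [sub_mul, mul_sub, BE, EB]; simp
    rw [this, gh, w, mul_assoc, i1, mul_one]
  have xa : h * (1 + B) * ((1 - B) * g) = E := by
    have : h * (1 + B) * ((1 - B) * g) = h * ((1 + B) * (1 - B)) * g := by simp only [mul_assoc]
    rw [this, i2, mul_one, hg']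
  refine ⟨h * (1 + B), ?_⟩
  rw [ha]
  refine ⟨?_, ?_, ?_, ?_⟩
  · rw [ax, ← mul_assoc, mul_sub, EB, mul_one, sub_mul, Eg, sub_mul, one_mul]
  · rw [xa, ← mul_assoc, Eh]
  · rw [ax, Es]
  · rw [xa, Es]

theorem stmt6 {R : Type*} [Ring R] [StarRing R] (p q : R)
    (hp : IsProjector p) (hq : IsProjector q)
    (hc0 : StarCancellable (p - q))
    (hc1 : StarCancellable (p * (1 - q))) (hc2 : StarCancellable (q * (1 - p))) :
    (∃ x, IsMP (p - q) x) ↔ (∃ x, IsMP (1 - p * q) x) := by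
  constructor
  · rintro ⟨t, ht⟩
    exact aux_fwd p q t hp hq ht
  · rintro ⟨x, hx⟩
    have r1 := aux_back p q x hp hq hc0 hx
    have hc0' : StarCancellable (q - p) := by
      have hn : q - p = -(p - q) := by abel
      rw [hn]
      refine ⟨fun y hy => ?_, fun y hy => ?_⟩
      · rw [neg_mul, hc0.1 y (by simpa only [star_neg, neg_mul_neg] using hy), neg_zero]
      · rw [mul_neg, hc0.2 y (by simpa only [star_neg, neg_mul_neg] using hy), neg_zero]
    have hx' : IsMP (1 - q * p) (star x) := by
      have hs : 1 - q * p = star (1 - p * q) := by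
        rw [star_sub, star_one, star_mul, hp.2, hq.2]
      obtain ⟨h1, h2, h3, h4⟩ := hx
      rw [hs]
      refine ⟨?_, ?_, ?_, ?_⟩
      · rw [← star_mul, ← star_mul, ← mul_assoc, h1]
      · rw [← star_mul, ← star_mul, ← mul_assoc, h2]
      · rw [← star_mul, h4, h4]
      · rw [← star_mul, h3, h3]
    have r2 := aux_back q p (star x) hq hp hc0' hx'
    rw [star_star] at r2
    have hd : star (p - q) = p - q := by rw [star_sub, hp.2, hq.2]
    have r3 : (p - q) * q = (p - q) * ((p - q) * (p - q) * (q * x)) := by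
      have hn : q - p = -(p - q) := by abel
      rw [hn] at r2
      simpa only [neg_mul_neg, neg_mul, mul_neg, neg_neg, neg_inj] using r2
    apply aux_self (p - q) (p * star x - q * x) hd
    generalize hdd : p - q = d at *
    have : d * (1 - d * (p * star x - q * x)) = 0 := by
      apply hc0.1
      rw [hd]
      have w : d * d * (1 - d * (p * star x - q * x)) = 
        d * d - (d * (d * d * (p * star x)) - d * (d * d * (q * x))) := by noncomm_ring
      rw [w, ← r1, ← r3, ← mul_sub, hdd, sub_self]
    rw [mul_sub, mul_one, sub_eq_zero, ← mul_assoc] at this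
    exact this
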